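/- arXiv:1307.6118 — 3 statements merged into one kernel-verified Lean document; each statement's English description precedes it below -/
import Mathlib

section
/- Let 𝔛 be a separable real normed space, 𝔜 ⊆ 𝔛 a closed subspace, X a compact Hausdorff space, and φ : 𝔜 → C(X,ℝ) a bounded linear map. Let m be a C(X)⁺-valued seminorm on 𝔛 that dominates φ and is locally balanced for φ. Then for every δ > 0 there exists a bounded linear map φ̃ : 𝔛 → C(X,ℝ) with φ̃(y) = φ(y) for all y ∈ 𝔜 and |φ̃(x)(t)| ≤ m(x)(t) + δ‖x‖ for all x ∈ 𝔛 and all t ∈ X. -/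
open Filter

variable {E : Type*} [NormedAddCommGroup E] [NormedSpace ℝ E]
  {X : Type*} [TopologicalSpace X]

/-- `m` is a `C(X)⁺`-valued seminorm on `E` relative to the set `S ⊆ X`:
pointwise (on `S`) nonnegative, lower semicontinuous on `S`, subadditive
and absolutely homogeneous. -/
def IsCxSeminormOn (S : Set X) (m : E → X → ℝ) : Prop :=
  (∀ x, ∀ t ∈ S, 0 ≤ m x t) ∧
  (∀ x, LowerSemicontinuousOn (m x) S) ∧
  (∀ x y, ∀ t ∈ S, m (x + y) t ≤ m x t + m y t) ∧
  (∀ (a : ℝ) (x : E), ∀ t ∈ S, m (a • x) t = |a| * m x t)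

/-- `m` dominates the linear map `φ : Y → C(X, ℝ)` at all points of `S`. -/
def DominatesOn (S : Set X) (m : E → X → ℝ) (Y : Submodule ℝ E)
    (φ : Y →L[ℝ] C(X, ℝ)) : Prop :=
  ∀ (y : Y), ∀ t ∈ S, |φ y t| ≤ m (y : E) t

/-- `m` is locally finite with respect to the subspace `Y`, relative to the set
`S ⊆ X`: it is bounded and there is a complementary subspace `Yc` with `Y + Yc`
dense such that every point `t₀ ∈ S` satisfies condition (i) or condition (ii),
with neighbourhoods taken inside `S`. -/
def LocallyFiniteSeminormOn (S : Set X) (m : E → X → ℝ) (Y : Submodule ℝ E) : Prop :=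
  (∃ C > 0, ∀ x, ∀ t ∈ S, m x t ≤ C * ‖x‖) ∧
  ∃ Yc : Submodule ℝ E, Dense ((Y ⊔ Yc : Submodule ℝ E) : Set E) ∧
    ∀ t₀ ∈ S,
      (∀ x ∈ Yc, ∀ ε > 0, ∃ U ∈ nhds t₀, ∀ t ∈ U ∩ S, m x t < ε) ∨
      (∃ F L : Submodule ℝ E, F ≤ Y ∧ L ≤ Y ∧ FiniteDimensional ℝ F ∧ F ⊔ L = Y ∧
        ∃ U ∈ nhds t₀, ∀ y ∈ L, ∀ t ∈ U ∩ S, m y t = 0)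

/-- `m` is balanced for `φ` relative to `S ⊆ X`: it dominates (on `S`) another
`C(X)⁺`-valued seminorm `m'` which is locally finite with respect to `Y` on `S`
and still dominates `φ` on `S`. -/
def BalancedOn (S : Set X) (m : E → X → ℝ) (Y : Submodule ℝ E)
    (φ : Y →L[ℝ] C(X, ℝ)) : Prop :=
  ∃ m' : E → X → ℝ, IsCxSeminormOn S m' ∧ (∀ x, ∀ t ∈ S, m' x t ≤ m x t) ∧
    LocallyFiniteSeminormOn S m' Y ∧ DominatesOn S m' Y φ

/-- `m` is locally balanced for `φ`: every point of `X` has an open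
neighbourhood `V` such that `m` restricted to `V` is balanced for `φ`
restricted to `V`. -/
def LocallyBalanced (m : E → X → ℝ) (Y : Submodule ℝ E)
    (φ : Y →L[ℝ] C(X, ℝ)) : Prop :=
  ∀ t : X, ∃ V : Set X, IsOpen V ∧ t ∈ V ∧ BalancedOn V m Y φ

open Topology

/-- A bounded subset of `F ⊔ L`, with `F` finite-dimensional, lies in a compact subset of `F`
up to the closure of `L`. -/
theorem exists_isCompact_lift_of_finiteDimensional {E : Type*} [NormedAddCommGroup E]
    [NormedSpace ℝ E] (F L : Submodule ℝ E) [FiniteDimensional ℝ F] (R : ℝ) :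
    ∃ K : Set E, IsCompact K ∧ K ⊆ F ∧
      ∀ y ∈ F ⊔ L, ‖y‖ ≤ R → ∃ k ∈ K, y - k ∈ L.topologicalClosure := by
  have : IsClosed (L.topologicalClosure : Set E) := L.isClosed_topologicalClosure
  let q : F →ₗ[ℝ] E ⧸ L.topologicalClosure := L.topologicalClosure.mkQ ∘ₗ F.subtype
  obtain ⟨r, hr⟩ := q.rangeRestrict.exists_rightInverse_of_surjective q.range_rangeRestrict
  have hrc : Continuous r := r.continuous_of_finiteDimensional
  refine ⟨(fun w => (r w : E)) '' Metric.closedBall 0 R,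
    (isCompact_closedBall _ _).image (continuous_subtype_val.comp hrc), ?_, ?_⟩
  · rintro _ ⟨w, -, rfl⟩
    exact (r w).2
  · intro y hy hyR
    obtain ⟨f, hf, l, hl, rfl⟩ := Submodule.mem_sup.1 hy
    have hfl : L.topologicalClosure.mkQ (f + l) = q ⟨f, hf⟩ := by
      have : L.topologicalClosure.mkQ l = 0 := by
        simpa using L.le_topologicalClosure hl
      rw [map_add, this, add_zero]
      rfl
    refine ⟨_, ⟨q.rangeRestrict ⟨f, hf⟩, ?_, rfl⟩, ?_⟩
    · rw [mem_closedBall_zero_iff]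
      change ‖q ⟨f, hf⟩‖ ≤ R
      rw [← hfl]
      exact (Submodule.Quotient.norm_mk_le _ _).trans hyR
    · rw [← Submodule.Quotient.mk_eq_zero, ← Submodule.mkQ_apply, map_sub, hfl, sub_eq_zero]
      have h := LinearMap.congr_fun hr (q.rangeRestrict ⟨f, hf⟩)
      exact (congrArg Subtype.val h).symm

/-- A closed subspace and a finite-dimensional subspace meeting only at `0` form a topological
direct sum. -/
theorem exists_norm_le_mul_norm_add_of_disjoint {E : Type*} [NormedAddCommGroup E]
    [NormedSpace ℝ E] {Y G : Submodule ℝ E} (hY : IsClosed (Y : Set E)) [FiniteDimensional ℝ G]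
    (h : Disjoint Y G) :
    ∃ D > 0, ∀ y ∈ Y, ∀ z ∈ G, ‖z‖ ≤ D * ‖y + z‖ := by
  have := hY
  let q : G →ₗ[ℝ] E ⧸ Y := Y.mkQ ∘ₗ G.subtype
  have hq : LinearMap.ker q = ⊥ := by
    rw [LinearMap.ker_eq_bot']
    intro z hz
    have : (z : E) ∈ Y := by simpa [q] using hz
    exact Subtype.ext (Submodule.disjoint_def.1 h _ this z.2)
  obtain ⟨D, hD, hanti⟩ := q.exists_antilipschitzWith hq
  refine ⟨D, by exact_mod_cast hD, fun y hy z hz => ?_⟩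
  have h1 : ‖(⟨z, hz⟩ : G)‖ ≤ D * ‖q ⟨z, hz⟩‖ := by
    simpa [dist_eq_norm] using hanti.le_mul_dist ⟨z, hz⟩ 0
  have h2 : q ⟨z, hz⟩ = Y.mkQ (y + z) := by
    have : Y.mkQ y = 0 := by simpa using hy
    rw [map_add, this, zero_add]
    rfl
  rw [h2] at h1
  exact h1.trans (by gcongr; exact Submodule.Quotient.norm_mk_le _ _)

section SeminormFamily

variable {E : Type*} [NormedAddCommGroup E] [NormedSpace ℝ E]
  {X : Type*} [TopologicalSpace X]

theorem abs_seminorm_sub_le {q : Seminorm ℝ E} {C : ℝ} (hC : ∀ x, q x ≤ C * ‖x‖) (x y : E) :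
    |q x - q y| ≤ C * ‖x - y‖ :=
  (abs_sub_map_le_sub q x y).trans (hC _)

theorem continuous_of_seminorm_le {q : Seminorm ℝ E} {C : ℝ} (hC : ∀ x, q x ≤ C * ‖x‖) :
    Continuous q := by
  refine (LipschitzWith.of_le_add_mul C.toNNReal fun x y => ?_).continuous
  have h1 := (abs_le.1 (abs_seminorm_sub_le hC x y)).2
  have h2 : C * ‖x - y‖ ≤ C.toNNReal * dist x y := by
    rw [dist_eq_norm]; gcongr; exact Real.le_coe_toNNReal C
  linarith

theorem eventually_forall_finiteDimensional_seminorm_le {p : X → Seminorm ℝ E} {C : ℝ}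
    (hC : ∀ t x, p t x ≤ C * ‖x‖) {G : Submodule ℝ E} [FiniteDimensional ℝ G] {t₀ : X}
    (h : ∀ z ∈ G, ∀ ε > 0, ∀ᶠ t in 𝓝 t₀, p t z < ε) {ε : ℝ} (hε : 0 < ε) :
    ∀ᶠ t in 𝓝 t₀, ∀ z ∈ G, p t z ≤ ε * ‖z‖ := by
  have key : ∀ᶠ t in 𝓝 t₀, ∀ z ∈ Metric.sphere (0 : G) 1, p t z < ε := by
    refine (isCompact_sphere (0 : G) 1).eventually_forall_of_forall_eventually fun z _ => ?_
    have h1 : ∀ᶠ w : G in 𝓝 z, C * ‖(w : E) - z‖ < ε / 2 := by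
      have : Continuous fun w : G => C * ‖(w : E) - z‖ := by fun_prop
      exact this.continuousAt.eventually_lt continuousAt_const (by simpa using hε)
    rw [nhds_prod_eq]
    filter_upwards [(h z z.2 (ε / 2) (half_pos hε)).prod_mk h1] with a ha
    have := (abs_le.1 (abs_seminorm_sub_le (hC a.1) (a.2 : E) z)).2
    linarith [ha.1, ha.2]
  filter_upwards [key] with t ht z hz
  rcases eq_or_ne z 0 with rfl | hz0
  · simp
  · have hn : 0 < ‖z‖ := norm_pos_iff.2 hz0
    have := ht (‖z‖⁻¹ • ⟨z, hz⟩) (by simp [norm_smul, hn.ne'])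
    simp only [Submodule.coe_smul, map_smul_eq_mul, norm_inv, norm_norm] at this
    rw [inv_mul_lt_iff₀ hn] at this
    linarith

/-- Extension by zero along `G` near a point where the seminorms tend to zero on `G`. -/
theorem eventually_abs_le_of_tendsto_zero {p : X → Seminorm ℝ E} {C : ℝ}
    (hC : ∀ t x, p t x ≤ C * ‖x‖) {Y G : Submodule ℝ E} (hY : IsClosed (Y : Set E))
    [FiniteDimensional ℝ G] (hd : Disjoint Y G) {φ : Y → C(X, ℝ)}
    (hφ : ∀ (y : Y) t, |φ y t| ≤ p t y) {t₀ : X}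
    (h : ∀ z ∈ G, ∀ ε > 0, ∀ᶠ t in 𝓝 t₀, p t z < ε) {η : ℝ} (hη : 0 < η) :
    ∀ᶠ t in 𝓝 t₀, ∀ y : Y, ∀ z ∈ G, |φ y t| ≤ p t (y + z) + η * ‖(y : E) + z‖ := by
  obtain ⟨D, hD, hDG⟩ := exists_norm_le_mul_norm_add_of_disjoint hY hd
  filter_upwards [eventually_forall_finiteDimensional_seminorm_le hC h (div_pos hη hD)]
    with t ht y z hz
  have h1 : p t (y : E) ≤ p t (y + z) + p t z := by
    simpa using map_sub_le_add (p t) ((y : E) + z) z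
  have h2 : η / D * ‖z‖ ≤ η * ‖(y : E) + z‖ := by
    calc η / D * ‖z‖ ≤ η / D * (D * ‖(y : E) + z‖) := by
          gcongr; exact hDG y y.2 z hz
      _ = _ := by field_simp
  linarith [hφ y t, ht z hz]

/-- A dominated functional has a dominated value at any further vector. -/
theorem exists_abs_add_le {q : Seminorm ℝ E} {f : E →ₗ.[ℝ] ℝ} {η : ℝ} (hη : 0 ≤ η)
    (hf : ∀ y : f.domain, |f y| ≤ q y + η * ‖(y : E)‖) (x : E) :
    ∃ c, ∀ y : f.domain, |f y + c| ≤ q (y + x) + η * ‖(y : E) + x‖ := by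
  obtain ⟨g, hgf, hg⟩ := exists_extension_of_le_sublinear f (fun x => q x + η * ‖x‖)
    (fun c hc x => by
      simp only [map_smul_eq_mul, norm_smul, Real.norm_of_nonneg hc.le]
      ring)
    (fun x y => by
      have h1 := map_add_le_add q x y
      have h2 : η * ‖x + y‖ ≤ η * (‖x‖ + ‖y‖) := by gcongr; exact norm_add_le x y
      linarith)
    (fun y => (le_abs_self _).trans (hf y))
  refine ⟨g x, fun y => ?_⟩
  rw [← hgf, ← map_add, abs_le]
  refine ⟨?_, hg _⟩
  have := hg (-(y + x))
  simp only [map_neg, map_neg_eq_map, norm_neg] at this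
  linarith

/-- Near a point where the problem has finite rank, a constant extends a dominated map to one
further vector, at an arbitrarily small loss. -/
theorem exists_const_eventually_abs_add_le {p : X → Seminorm ℝ E}
    (hp : ∀ x, LowerSemicontinuous fun t => p t x) {C : ℝ} (hC : ∀ t x, p t x ≤ C * ‖x‖)
    {f : E →ₗ.[ℝ] C(X, ℝ)} (hdc : IsClosed (f.domain : Set E)) {η η' : ℝ} (hη : 0 ≤ η)
    (hηη' : η < η') (hf : ∀ (y : f.domain) t, |f y t| ≤ p t y + η * ‖(y : E)‖)
    {F L : Submodule ℝ E} [FiniteDimensional ℝ F] (hFL : F ⊔ L = f.domain) {t₀ : X}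
    (hL : ∀ᶠ t in 𝓝 t₀, ∀ l : f.domain, (l : E) ∈ L.topologicalClosure →
      f l t = 0 ∧ p t l = 0) {x : E} (hx : x ∉ f.domain) :
    ∃ c : ℝ, ∀ᶠ t in 𝓝 t₀, ∀ y : f.domain,
      |f y t + c| ≤ p t (y + x) + η' * ‖(y : E) + x‖ := by
  let ev (t : X) : C(X, ℝ) →ₗ[ℝ] ℝ :=
    { toFun := fun g => g t, map_add' := fun _ _ => rfl, map_smul' := fun _ _ => rfl }
  obtain ⟨c, hc⟩ := exists_abs_add_le (q := p t₀) (f := ⟨f.domain, ev t₀ ∘ₗ f.toFun⟩) hη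
    (fun y => hf y t₀) x
  replace hc : ∀ y : f.domain, |f y t₀ + c| ≤ p t₀ (y + x) + η * ‖(y : E) + x‖ := hc
  refine ⟨c, ?_⟩
  have hC0 : 0 ≤ C * ‖x‖ := (apply_nonneg (p t₀) x).trans (hC t₀ x)
  obtain ⟨d, hd, hdx⟩ : ∃ d > 0, ∀ y ∈ f.domain, d ≤ ‖y + x‖ := by
    refine ⟨Metric.infDist x f.domain,
      (hdc.notMem_iff_infDist_pos ⟨0, f.domain.zero_mem⟩).1 hx, fun y hy => ?_⟩
    have := Metric.infDist_le_dist_of_mem (x := x) (f.domain.neg_mem hy)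
    rwa [dist_eq_norm, sub_neg_eq_add, add_comm] at this
  set B := (|c| + C * ‖x‖ + η * ‖x‖) / (η' - η) with hB
  have hs : 0 < η' - η := sub_pos.2 hηη'
  obtain ⟨K, hK, hKF, hKL⟩ := exists_isCompact_lift_of_finiteDimensional F L (B + ‖x‖)
  have hKd : ∀ k ∈ K, k ∈ f.domain := fun k hk => hFL ▸ Submodule.mem_sup_left (hKF hk)
  have hflip : ∀ (a b : f.domain) t, |f a t - f b t| ≤ (C + η) * ‖(a : E) - b‖ := by
    intro a b t
    have h1 := hf (a - b) t
    have h2 := hC t (a - b)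
    rw [f.map_sub] at h1
    simp only [ContinuousMap.sub_apply, Submodule.coe_sub] at h1
    linarith
  have hKc : IsCompact ((↑) ⁻¹' K : Set f.domain) :=
    hdc.isClosedEmbedding_subtypeVal.isCompact_preimage hK
  set ε := (η' - η) * d with hε
  have hε0 : 0 < ε := mul_pos hs hd
  have key : ∀ᶠ t in 𝓝 t₀, ∀ k ∈ ((↑) ⁻¹' K : Set f.domain),
      |f k t - f k t₀| + p t₀ (k + x) - p t (k + x) < ε := by
    refine hKc.eventually_forall_of_forall_eventually fun k _ => ?_
    have h1 : ∀ᶠ w : f.domain in 𝓝 k, (4 * C + 2 * η) * ‖(w : E) - k‖ < ε / 3 := by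
      have : Continuous fun w : f.domain => (4 * C + 2 * η) * ‖(w : E) - k‖ := by fun_prop
      exact this.continuousAt.eventually_lt continuousAt_const (by simp; positivity)
    have h2 : ∀ᶠ t in 𝓝 t₀, |f k t - f k t₀| < ε / 3 := by
      have : Continuous fun t => |f k t - f k t₀| := by fun_prop
      exact this.continuousAt.eventually_lt continuousAt_const (by simp; positivity)
    have h3 : ∀ᶠ t in 𝓝 t₀, p t₀ (k + x) - ε / 3 < p t (k + x) :=
      hp (k + x) t₀ _ (by linarith)
    rw [nhds_prod_eq]
    filter_upwards [(h2.and h3).prod_mk h1] with a ha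
    obtain ⟨⟨ha2, ha3⟩, ha1⟩ := ha
    have e1 := hflip a.2 k a.1
    have e2 := hflip a.2 k t₀
    have e3 := abs_seminorm_sub_le (hC a.1) ((a.2 : E) + x) (k + x)
    have e4 := abs_seminorm_sub_le (hC t₀) ((a.2 : E) + x) (k + x)
    rw [add_sub_add_right_eq_sub] at e3 e4
    rw [abs_le] at e1 e2 e3 e4
    rw [abs_lt] at ha2
    have : |f a.2 a.1 - f a.2 t₀| ≤ 2 * ((C + η) * ‖(a.2 : E) - k‖) + ε / 3 :=
      abs_le.2 ⟨by linarith, by linarith⟩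
    linarith
  have hL0 := hL.self_of_nhds
  filter_upwards [hL, key] with t htL htK y
  rcases le_or_gt B ‖(y : E) + x‖ with hbig | hsmall
  · have h1 : |c| + C * ‖x‖ + η * ‖x‖ ≤ (η' - η) * ‖(y : E) + x‖ := by
      rwa [hB, div_le_iff₀' hs] at hbig
    have h2 : p t (y : E) ≤ p t (y + x) + p t x := by
      simpa using map_sub_le_add (p t) ((y : E) + x) x
    have h3 : η * ‖(y : E)‖ ≤ η * (‖(y : E) + x‖ + ‖x‖) := by
      gcongr
      simpa using norm_sub_le ((y : E) + x) x
    linarith [abs_add_le (f y t) c, hf y t, hC t x]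
  · obtain ⟨k, hk, hyk⟩ := hKL y (by rw [hFL]; exact y.2) (by
      have : ‖(y : E)‖ ≤ ‖(y : E) + x‖ + ‖x‖ := by simpa using norm_sub_le ((y : E) + x) x
      linarith)
    obtain ⟨k, rfl⟩ : ∃ k' : f.domain, (k' : E) = k := ⟨⟨k, hKd k hk⟩, rfl⟩
    have hfy : ∀ s, f (y - k) s = 0 → f y s = f k s := by
      intro s h
      rw [f.map_sub, ContinuousMap.sub_apply] at h
      linarith
    have hpy : ∀ s, p s ((y - k : f.domain) : E) = 0 → p s (y + x) = p s (k + x) := by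
      intro s h
      have := abs_sub_map_le_sub (p s) ((y : E) + x) (k + x)
      rw [add_sub_add_right_eq_sub, ← Submodule.coe_sub, h] at this
      exact sub_eq_zero.1 (abs_nonpos_iff.1 this)
    obtain ⟨a1, a2⟩ := htL (y - k) hyk
    obtain ⟨b1, b2⟩ := hL0 (y - k) hyk
    have h1 := hc y
    rw [hfy _ b1, hpy _ b2] at h1
    rw [hfy _ a1, hpy _ a2]
    have h2 := htK k hk
    have h3 : ε ≤ (η' - η) * ‖(y : E) + x‖ := by
      rw [hε]; gcongr; exact hdx y y.2
    have h4 : |f k t + c| ≤ |f k t - f k t₀| + |f k t₀ + c| := by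
      rw [show f k t + c = (f k t - f k t₀) + (f k t₀ + c) by ring]
      exact abs_add_le _ _
    linarith

/-- Gluing of local constants into a continuous function vanishing near a prescribed closed set. -/
theorem exists_continuous_forall_mem_convex_eventually_eq_zero [T2Space X] [CompactSpace X]
    {A : X → Set ℝ} (hA : ∀ t, Convex ℝ (A t)) {T : Set X} (hT : IsClosed T)
    (hloc : ∀ t₀, ∃ c, (t₀ ∈ T → c = 0) ∧ ∀ᶠ t in 𝓝 t₀, c ∈ A t) :
    ∃ g : C(X, ℝ), (∀ t, g t ∈ A t) ∧ ∀ t₀ ∈ T, ∀ᶠ t in 𝓝 t₀, g t = 0 := by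
  have hTN : T ⊆ interior {t | (0 : ℝ) ∈ A t} := by
    intro t₀ ht₀
    obtain ⟨c, hc, hcA⟩ := hloc t₀
    rw [hc ht₀] at hcA
    exact mem_interior_iff_mem_nhds.2 hcA
  obtain ⟨M, hMo, hTM, hMN⟩ := normal_exists_closure_subset hT isOpen_interior hTN
  obtain ⟨g, hg⟩ := exists_continuous_forall_mem_convex_of_local_const
    (t := fun t => {c | c ∈ A t ∧ (t ∈ closure M → c = 0)})
    (fun t => by
      by_cases ht : t ∈ closure M
      · have h0 : {c : ℝ | t ∈ closure M → c = 0} = {0} := by ext; simp [ht]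
        exact (hA t).inter (t := {c | t ∈ closure M → c = 0})
          (by rw [h0]; exact convex_singleton _)
      · simpa [ht] using hA t)
    (fun t₀ => by
      by_cases ht₀ : t₀ ∈ closure M
      · refine ⟨0, ?_⟩
        filter_upwards [mem_interior_iff_mem_nhds.1 (hMN ht₀)] with t ht
        exact ⟨ht, fun _ => rfl⟩
      · obtain ⟨c, -, hc⟩ := hloc t₀
        refine ⟨c, ?_⟩
        filter_upwards [hc, isClosed_closure.isOpen_compl.mem_nhds ht₀] with t h1 h2
        exact ⟨h1, fun h => absurd h h2⟩)
  refine ⟨g, fun t => (hg t).1, fun t₀ ht₀ => ?_⟩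
  filter_upwards [hMo.mem_nhds (hTM ht₀)] with t ht
  exact (hg t).2 (subset_closure ht)

/-- A partial extension of `φ` to the sum of `Y` and a finite-dimensional subspace of `Yc`, within
`η` of being dominated by `p`, and vanishing on the new vectors near each point of `T`. -/
structure IsControlledExtension (p : X → Seminorm ℝ E) (Y Yc : Submodule ℝ E)
    (φ : Y →ₗ[ℝ] C(X, ℝ)) (T : Set X) (η : ℝ) (f : E →ₗ.[ℝ] C(X, ℝ)) : Prop where
  le : (⟨Y, φ⟩ : E →ₗ.[ℝ] C(X, ℝ)) ≤ f
  exists_domain_eq : ∃ G ≤ Yc, FiniteDimensional ℝ G ∧ Disjoint Y G ∧ f.domain = Y ⊔ G ∧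
    ∀ t₀ ∈ T, ∀ᶠ t in 𝓝 t₀, ∀ z : f.domain, (z : E) ∈ G → f z t = 0
  abs_le : ∀ (y : f.domain) t, |f y t| ≤ p t y + η * ‖(y : E)‖

theorem IsControlledExtension.exists_ge [T2Space X] [CompactSpace X] {p : X → Seminorm ℝ E}
    (hp : ∀ x, LowerSemicontinuous fun t => p t x) {C : ℝ} (hC : ∀ t x, p t x ≤ C * ‖x‖)
    {Y Yc : Submodule ℝ E} (hY : IsClosed (Y : Set E)) {φ : Y →ₗ[ℝ] C(X, ℝ)}
    (hφ : ∀ (y : Y) t, |φ y t| ≤ p t y) {T : Set X} (hTc : IsClosed T)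
    (hT : ∀ t₀ ∈ T, ∀ z ∈ Yc, ∀ ε > 0, ∀ᶠ t in 𝓝 t₀, p t z < ε)
    (hW : ∀ t₀ ∉ T, ∃ F L : Submodule ℝ E, FiniteDimensional ℝ F ∧ F ⊔ L = Y ∧
      ∀ᶠ t in 𝓝 t₀, ∀ y ∈ L, p t y = 0)
    {η η' : ℝ} (hη : 0 ≤ η) (hηη' : η < η') {f : E →ₗ.[ℝ] C(X, ℝ)}
    (hf : IsControlledExtension p Y Yc φ T η f) {x : E} (hx : x ∈ Yc) :
    ∃ f', f ≤ f' ∧ IsControlledExtension p Y Yc φ T η' f' ∧ x ∈ f'.domain := by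
  have hfη' : ∀ (y : f.domain) t, |f y t| ≤ p t y + η' * ‖(y : E)‖ := fun y t =>
    (hf.abs_le y t).trans (by gcongr)
  by_cases hxf : x ∈ f.domain
  · exact ⟨f, le_rfl, ⟨hf.le, hf.exists_domain_eq, hfη'⟩, hxf⟩
  obtain ⟨G, hGYc, hGfin, hYG, hdom, hG0⟩ := hf.exists_domain_eq
  have hdc : IsClosed (f.domain : Set E) := by
    rw [hdom]; exact Submodule.isClosed_sup_finiteDimensional _ _ hY
  have hYf : Y ≤ f.domain := hf.le.1
  have hGf : G ≤ f.domain := hdom ▸ le_sup_right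
  have hfφ : ∀ (y : f.domain) (hy : (y : E) ∈ Y), f y = φ ⟨y, hy⟩ := fun y hy =>
    (hf.le.2 (x := ⟨y, hy⟩) (y := y) rfl).symm
  have hYG' : Disjoint Y (G ⊔ Submodule.span ℝ {x}) := by
    refine hYG.disjoint_sup_right_of_disjoint_sup_left ?_
    rw [← hdom, Submodule.disjoint_span_singleton]
    exact fun h => absurd h hxf
  have hG'Yc : G ⊔ Submodule.span ℝ {x} ≤ Yc :=
    sup_le hGYc ((Submodule.span_singleton_le_iff_mem _ _).2 hx)
  have hη'0 : 0 < η' := hη.trans_lt hηη'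
  obtain ⟨g, hg, hg0⟩ := exists_continuous_forall_mem_convex_eventually_eq_zero
    (A := fun t => {c | ∀ y : f.domain, |f y t + c| ≤ p t (y + x) + η' * ‖(y : E) + x‖})
    (fun t => by
      simp only [Set.ofPred_forall]
      refine convex_iInter fun y => ?_
      have : {c : ℝ | |f y t + c| ≤ p t (y + x) + η' * ‖(y : E) + x‖} =
          Set.Icc (-(p t (y + x) + η' * ‖(y : E) + x‖) - f y t)
            (p t (y + x) + η' * ‖(y : E) + x‖ - f y t) := by
        ext c
        rw [Set.mem_ofPred_eq, Set.mem_Icc, _root_.abs_le]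
        constructor <;> rintro ⟨h1, h2⟩ <;> constructor <;> linarith
      exact this ▸ convex_Icc _ _)
    hTc
    (fun t₀ => by
      by_cases ht₀ : t₀ ∈ T
      · refine ⟨0, fun _ => rfl, ?_⟩
        filter_upwards [eventually_abs_le_of_tendsto_zero hC hY hYG' hφ
          (fun z hz => hT t₀ ht₀ z (hG'Yc hz)) hη'0, hG0 t₀ ht₀] with t h1 h2 y
        obtain ⟨a, ha, b, hb, hab⟩ := Submodule.mem_sup.1 (hdom ▸ y.2 : (y : E) ∈ Y ⊔ G)
        have e1 : y = (⟨a, hYf ha⟩ : f.domain) + ⟨b, hGf hb⟩ := Subtype.ext hab.symm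
        have e2 : f y t = φ ⟨a, ha⟩ t := by
          rw [e1, f.map_add, ContinuousMap.add_apply, h2 ⟨b, hGf hb⟩ hb, add_zero,
            hfφ ⟨a, hYf ha⟩ ha]
        rw [e2, add_zero, ← hab, add_assoc]
        exact h1 ⟨a, ha⟩ (b + x) (add_mem (Submodule.mem_sup_left hb)
          (Submodule.mem_sup_right (Submodule.mem_span_singleton_self x)))
      · obtain ⟨F, L, hF, hFL, hL⟩ := hW t₀ ht₀
        have hLY : L.topologicalClosure ≤ Y :=
          L.topologicalClosure_minimal (hFL ▸ le_sup_right) hY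
        obtain ⟨c, hc⟩ := exists_const_eventually_abs_add_le hp hC hdc hη hηη' hf.abs_le
          (F := F ⊔ G) (L := L) (t₀ := t₀) (by rw [hdom, ← hFL, sup_right_comm]) (by
            filter_upwards [hL] with t ht l hl
            have hz : p t (l : E) = 0 := by
              have hclosed : IsClosed {y : E | p t y = 0} :=
                isClosed_eq (continuous_of_seminorm_le (hC t)) continuous_const
              exact closure_minimal (s := (L : Set E)) ht hclosed hl
            refine ⟨?_, hz⟩
            rw [hfφ l (hLY hl)]
            exact abs_nonpos_iff.1 ((hφ ⟨l, hLY hl⟩ t).trans hz.le)) hxf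
        exact ⟨c, fun h => absurd h ht₀, hc⟩)
  have hle : f ≤ f.supSpanSingleton x g hxf := LinearPMap.left_le_sup _ _ _
  have hval : ∀ y' : (f.supSpanSingleton x g hxf).domain, ∃ (y : f.domain) (a : ℝ),
      (y' : E) = y + a • x ∧ f.supSpanSingleton x g hxf y' = f y + a • g := by
    rintro ⟨y', hy'⟩
    obtain ⟨y, hy, w, hw, rfl⟩ := Submodule.mem_sup.1 hy'
    obtain ⟨a, rfl⟩ := Submodule.mem_span_singleton.1 hw
    exact ⟨⟨y, hy⟩, a, rfl, f.supSpanSingleton_apply_mk x g hxf y hy a⟩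
  refine ⟨f.supSpanSingleton x g hxf, hle, ⟨hf.le.trans hle, ?_, ?_⟩,
    Submodule.mem_sup_right (Submodule.mem_span_singleton_self x)⟩
  · refine ⟨G ⊔ Submodule.span ℝ {x}, hG'Yc, inferInstance, hYG', ?_, fun t₀ ht₀ => ?_⟩
    · rw [LinearPMap.domain_supSpanSingleton, hdom, sup_assoc]
    · filter_upwards [hG0 t₀ ht₀, hg0 t₀ ht₀] with t h1 h2
      rintro ⟨z, hz'⟩ hz
      obtain ⟨b, hb, w, hw, rfl⟩ := Submodule.mem_sup.1 hz
      obtain ⟨a, rfl⟩ := Submodule.mem_span_singleton.1 hw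
      rw [f.supSpanSingleton_apply_mk x g hxf b (hGf hb) a]
      simp [h1 ⟨b, hGf hb⟩ hb, h2]
  · intro y' t
    obtain ⟨y, a, h1, h2⟩ := hval y'
    rw [h1, h2]
    rcases eq_or_ne a 0 with rfl | ha
    · simpa using hfη' y t
    · have h3 := mul_le_mul_of_nonneg_left (hg t (a⁻¹ • y)) (abs_nonneg a)
      have e1 : (y : E) + a • x = a • (((a⁻¹ • y : f.domain) : E) + x) := by
        rw [smul_add, Submodule.coe_smul, smul_inv_smul₀ ha]
      have e2 : (f y + a • g) t = a * (f (a⁻¹ • y) t + g t) := by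
        rw [f.map_smul]
        simp only [ContinuousMap.add_apply, ContinuousMap.smul_apply, smul_eq_mul]
        field_simp
      rw [e1, e2, abs_mul, map_smul_eq_mul, norm_smul, Real.norm_eq_abs]
      linarith

/-- The extension theorem for a locally finite family of seminorms on a compact space. -/
theorem exists_extension_of_locallyFinite [TopologicalSpace.SeparableSpace E] [T2Space X]
    [CompactSpace X] {p : X → Seminorm ℝ E}
    (hp : ∀ x, LowerSemicontinuous fun t => p t x) {C : ℝ} (hC : ∀ t x, p t x ≤ C * ‖x‖)
    {Y Yc : Submodule ℝ E} (hY : IsClosed (Y : Set E))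
    (hd : Dense ((Y ⊔ Yc : Submodule ℝ E) : Set E)) {φ : Y →ₗ[ℝ] C(X, ℝ)}
    (hφ : ∀ (y : Y) t, |φ y t| ≤ p t y)
    (hloc : ∀ t₀, (∀ z ∈ Yc, ∀ ε > 0, ∀ᶠ t in 𝓝 t₀, p t z < ε) ∨
      ∃ F L : Submodule ℝ E, FiniteDimensional ℝ F ∧ F ⊔ L = Y ∧
        ∀ᶠ t in 𝓝 t₀, ∀ y ∈ L, p t y = 0) {δ : ℝ} (hδ : 0 < δ) :
    ∃ ψ : E →L[ℝ] C(X, ℝ), (∀ y : Y, ψ y = φ y) ∧ ∀ x t, |ψ x t| ≤ p t x + δ * ‖x‖ := by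
  set T : Set X := {t₀ | ∃ F L : Submodule ℝ E, FiniteDimensional ℝ F ∧ F ⊔ L = Y ∧
        ∀ᶠ t in 𝓝 t₀, ∀ y ∈ L, p t y = 0}ᶜ with hTdef
  have hTc : IsClosed T := by
    rw [isClosed_compl_iff, isOpen_iff_mem_nhds]
    rintro t₀ ⟨F, L, hF, hFL, h⟩
    filter_upwards [eventually_eventually_nhds.2 h] with t ht
    exact ⟨F, L, hF, hFL, ht⟩
  have hT : ∀ t₀ ∈ T, ∀ z ∈ Yc, ∀ ε > 0, ∀ᶠ t in 𝓝 t₀, p t z < ε := fun t₀ ht₀ =>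
    (hloc t₀).resolve_right ht₀
  have hW : ∀ t₀ ∉ T, ∃ F L : Submodule ℝ E, FiniteDimensional ℝ F ∧ F ⊔ L = Y ∧
        ∀ᶠ t in 𝓝 t₀, ∀ y ∈ L, p t y = 0 := fun t₀ ht₀ => not_not.1 ht₀
  have : SecondCountableTopology E := UniformSpace.secondCountable_of_separable E
  let z : ℕ → Yc := TopologicalSpace.denseSeq Yc
  let η : ℕ → ℝ := fun n => δ * (1 - (1 / 2) ^ n)
  have hη0 : ∀ n, 0 ≤ η n := fun n =>
    mul_nonneg hδ.le (sub_nonneg.2 (pow_le_one₀ (by norm_num) (by norm_num)))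
  have hηδ : ∀ n, η n ≤ δ := fun n =>
    mul_le_of_le_one_right hδ.le (by simp)
  have hηlt : ∀ n, η n < η (n + 1) := fun n =>
    mul_lt_mul_of_pos_left (by
      have : (0 : ℝ) < (1 / 2) ^ n := by positivity
      rw [pow_succ]; linarith) hδ
  let P : ℕ → (E →ₗ.[ℝ] C(X, ℝ)) → Prop := fun n f => IsControlledExtension p Y Yc φ T (η n) f
  have hP0 : P 0 ⟨Y, φ⟩ := by
    refine ⟨le_rfl, ⟨⊥, bot_le, inferInstance, disjoint_bot_right, by simp, fun t₀ _ => ?_⟩, ?_⟩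
    · refine Filter.Eventually.of_forall fun t y hy => ?_
      have : y = 0 := Subtype.ext (by simpa using hy)
      rw [this, LinearPMap.map_zero]
      rfl
    · intro y t
      simpa [η] using hφ y t
  have hstep : ∀ n (f : {f // P n f}), ∃ f' : {f' // P (n + 1) f'},
      f.1 ≤ f'.1 ∧ (z n : E) ∈ f'.1.domain := by
    rintro n ⟨f, hf⟩
    obtain ⟨f', h1, h2, h3⟩ := hf.exists_ge hp hC hY hφ hTc hT hW (hη0 n) (hηlt n) (z n).2
    exact ⟨⟨f', h2⟩, h1, h3⟩
  choose next hnext hmem using hstep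
  let s : ∀ n, {f // P n f} := fun n => Nat.rec ⟨_, hP0⟩ next n
  have hmono : Monotone fun n => (s n).1 := monotone_nat_of_le_succ fun n => hnext n (s n)
  have hdir : DirectedOn (· ≤ ·) (Set.range fun n => (s n).1) := by
    rintro _ ⟨i, rfl⟩ _ ⟨j, rfl⟩
    exact ⟨_, ⟨max i j, rfl⟩, hmono (le_max_left i j), hmono (le_max_right i j)⟩
  set f := LinearPMap.sSup _ hdir with hfdef
  have hsf : ∀ n, (s n).1 ≤ f := fun n => LinearPMap.le_sSup hdir ⟨n, rfl⟩
  have hbound : ∀ (y : f.domain) t, |f y t| ≤ p t y + δ * ‖(y : E)‖ := by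
    intro y t
    obtain ⟨_, ⟨n, rfl⟩, hy⟩ := (LinearPMap.mem_domain_sSup_iff (Set.range_nonempty _) hdir).1 y.2
    have h1 : (s n).1 ⟨y, hy⟩ = f y := (hsf n).2 rfl
    rw [← h1]
    exact ((s n).2.abs_le _ t).trans (by gcongr; exact hηδ n)
  have hYf : Y ≤ f.domain := (hsf 0).1
  have hYcf : Yc ≤ f.domain.topologicalClosure := by
    intro x hx
    have h1 : (⟨x, hx⟩ : Yc) ∈ closure (Set.range z) := TopologicalSpace.denseRange_denseSeq Yc _
    have h2 := map_mem_closure continuous_subtype_val h1 (t := (f.domain : Set E)) (by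
      rintro _ ⟨n, rfl⟩
      exact (hsf (n + 1)).1 (hmem n (s n)))
    exact h2
  have hdense : DenseRange f.domain.subtypeL := by
    have h1 : (Y ⊔ Yc : Submodule ℝ E) ≤ f.domain.topologicalClosure :=
      sup_le (hYf.trans f.domain.le_topologicalClosure) hYcf
    have h2 : Dense (f.domain : Set E) := dense_closure.1 (hd.mono h1)
    simpa [DenseRange] using h2
  let f₁ : f.domain →L[ℝ] C(X, ℝ) := f.toFun.mkContinuous (|C| + δ) fun y => by
    refine (ContinuousMap.norm_le _ (by positivity)).2 fun t => ?_
    have h1 := hbound y t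
    have h2 : C * ‖(y : E)‖ ≤ |C| * ‖(y : E)‖ := by gcongr; exact le_abs_self C
    have h3 := hC t y
    change |f y t| ≤ (|C| + δ) * ‖(y : E)‖
    linarith
  let ψ : E →L[ℝ] C(X, ℝ) := f₁.extend f.domain.subtypeL
  have hψ : ∀ y : f.domain, ψ y = f y := fun y =>
    f₁.extend_eq hdense isUniformEmbedding_subtype_val.isUniformInducing y
  refine ⟨ψ, fun y => ?_, fun x t => ?_⟩
  · rw [show (y : E) = ((⟨y, hYf y.2⟩ : f.domain) : E) from rfl, hψ]
    exact ((hsf 0).2 (x := y) rfl).symm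
  · refine hdense.induction_on (p := fun x => |ψ x t| ≤ p t x + δ * ‖x‖) x ?_ fun y => ?_
    · refine isClosed_le ?_ ((continuous_of_seminorm_le (hC t)).add (continuous_const.mul continuous_norm))
      exact ((continuous_eval_const t).comp ψ.continuous).abs
    · change |ψ (y : E) t| ≤ _
      rw [hψ]
      exact hbound y t

end SeminormFamily

/-- On a compact subset of a set where `m` is balanced, `φ` extends within `m + δ‖·‖`. -/
theorem BalancedOn.exists_extension_on_compact {E : Type*} [NormedAddCommGroup E]
    [NormedSpace ℝ E] [TopologicalSpace.SeparableSpace E] {X : Type*} [TopologicalSpace X]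
    [CompactSpace X] [T2Space X] {V : Set X} {m : E → X → ℝ} {Y : Submodule ℝ E}
    {φ : Y →L[ℝ] C(X, ℝ)} (h : BalancedOn V m Y φ) (hY : IsClosed (Y : Set E)) {K : Set X}
    (hK : IsCompact K) (hKV : K ⊆ V) {δ : ℝ} (hδ : 0 < δ) :
    ∃ ψ : E →L[ℝ] C(K, ℝ), (∀ (y : Y) t, ψ y t = φ y t) ∧
      ∀ x (t : K), |ψ x t| ≤ m x t + δ * ‖x‖ := by
  have : CompactSpace K := isCompact_iff_compactSpace.1 hK
  obtain ⟨m', ⟨-, hlsc, hadd, hsmul⟩, hm'm, ⟨⟨C, -, hC⟩, Yc, hd, hloc⟩, hdom⟩ := h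
  let p : K → Seminorm ℝ E := fun t => Seminorm.of (fun x => m' x t)
    (fun x y => hadd x y t (hKV t.2)) (fun a x => hsmul a x t (hKV t.2))
  let φK : Y →ₗ[ℝ] C(K, ℝ) :=
    { toFun := fun y => (φ y).restrict K
      map_add' := fun y z => by rw [map_add]; rfl
      map_smul' := fun a y => by rw [map_smul]; rfl }
  have hpull : ∀ {t₀ : K} {U : Set X}, U ∈ 𝓝 (t₀ : X) → ∀ᶠ t : K in 𝓝 t₀, (t : X) ∈ U ∩ V :=
    fun hU => (continuous_subtype_val.continuousAt.eventually hU).mono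
      fun t ht => ⟨ht, hKV t.2⟩
  obtain ⟨ψ, hψφ, hψp⟩ := exists_extension_of_locallyFinite (p := p) (C := C) (φ := φK)
    (fun x t c hc => by
      have h1 := hlsc x t (hKV t.2) c hc
      have h2 : Filter.Tendsto ((↑) : K → X) (𝓝 t) (𝓝[V] (t : X)) :=
        tendsto_nhdsWithin_iff.2 ⟨continuous_subtype_val.continuousAt,
          Filter.Eventually.of_forall fun s => hKV s.2⟩
      exact h2.eventually h1)
    (fun t x => hC x t (hKV t.2)) hY hd (fun y t => hdom y t (hKV t.2))
    (fun t₀ => by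
      rcases hloc t₀ (hKV t₀.2) with h1 | ⟨F, L, -, -, hF, hFL, U, hU, hUL⟩
      · refine Or.inl fun z hz ε hε => ?_
        obtain ⟨U, hU, hUz⟩ := h1 z hz ε hε
        exact (hpull hU).mono fun t ht => hUz t ht
      · exact Or.inr ⟨F, L, hF, hFL, (hpull hU).mono fun t ht y hy => hUL y hy t ht⟩) hδ
  refine ⟨ψ, fun y t => by rw [hψφ]; rfl, fun x t => (hψp x t).trans ?_⟩
  gcongr
  exact hm'm x t (hKV t.2)

/-- Lemma 1. Let `E` be a separable real normed space, `Y ⊆ E` a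
closed subspace, `X` a compact Hausdorff space and `φ : Y → C(X, ℝ)` a bounded linear
map.  Let `m` be a `C(X)⁺`-valued seminorm on `E` dominating `φ` which is locally
balanced for `φ`.  Then for every `δ > 0` there is a bounded linear extension `ψ` of
`φ` to all of `E` with `|ψ x t| ≤ m x t + δ‖x‖` for all `x` and `t`. -/
theorem stmt1
    {E : Type*} [NormedAddCommGroup E] [NormedSpace ℝ E]
    [TopologicalSpace.SeparableSpace E]
    {X : Type*} [TopologicalSpace X] [CompactSpace X] [T2Space X]
    (Y : Submodule ℝ E) (hYclosed : IsClosed (Y : Set E))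
    (φ : Y →L[ℝ] C(X, ℝ))
    (m : E → X → ℝ)
    (hm : IsCxSeminormOn (Set.univ : Set X) m)
    (hdom : DominatesOn (Set.univ : Set X) m Y φ)
    (hbal : LocallyBalanced m Y φ)
    (δ : ℝ) (hδ : 0 < δ) :
    ∃ ψ : E →L[ℝ] C(X, ℝ),
      (∀ y : Y, ψ (y : E) = φ y) ∧
      ∀ (x : E) (t : X), |ψ x t| ≤ m x t + δ * ‖x‖ := by
  let S : X → Set ((E → ℝ) × ℝ) := fun t => {w |
    (∀ a b, w.1 (a + b) = w.1 a + w.1 b) ∧ (∀ (r : ℝ) a, w.1 (r • a) = r * w.1 a) ∧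
    (∀ y : Y, w.1 y = φ y t) ∧ (∀ x, |w.1 x| ≤ m x t + δ * ‖x‖) ∧ ∀ x, |w.1 x| ≤ w.2 * ‖x‖}
  have hS : ∀ t, Convex ℝ (S t) := by
    rintro t v ⟨hv1, hv2, hv3, hv4, hv5⟩ w ⟨hw1, hw2, hw3, hw4, hw5⟩ a b ha hb hab
    have habs : ∀ x, |a * v.1 x + b * w.1 x| ≤ a * |v.1 x| + b * |w.1 x| := fun x => by
      simpa only [abs_mul, abs_of_nonneg ha, abs_of_nonneg hb] using
        abs_add_le (a * v.1 x) (b * w.1 x)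
    refine ⟨fun x y => ?_, fun r x => ?_, fun y => ?_, fun x => ?_, fun x => ?_⟩
    · change a * v.1 (x + y) + b * w.1 (x + y) = a * v.1 x + b * w.1 x + (a * v.1 y + b * w.1 y)
      rw [hv1, hw1]; ring
    · change a * v.1 (r • x) + b * w.1 (r • x) = r * (a * v.1 x + b * w.1 x)
      rw [hv2, hw2]; ring
    · change a * v.1 y + b * w.1 y = φ y t
      rw [hv3, hw3, ← add_mul, hab, one_mul]
    · change |a * v.1 x + b * w.1 x| ≤ _
      calc _ ≤ a * |v.1 x| + b * |w.1 x| := habs x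
        _ ≤ a * (m x t + δ * ‖x‖) + b * (m x t + δ * ‖x‖) := by
          gcongr
          exacts [hv4 x, hw4 x]
        _ = m x t + δ * ‖x‖ := by rw [← add_mul, hab, one_mul]
    · change |a * v.1 x + b * w.1 x| ≤ (a * v.2 + b * w.2) * ‖x‖
      calc _ ≤ a * |v.1 x| + b * |w.1 x| := habs x
        _ ≤ a * (v.2 * ‖x‖) + b * (w.2 * ‖x‖) := by
          gcongr
          exacts [hv5 x, hw5 x]
        _ = _ := by ring
  obtain ⟨g, hg⟩ := exists_continuous_forall_mem_convex_of_local hS fun t₀ => by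
    obtain ⟨V, hVo, htV, hV⟩ := hbal t₀
    obtain ⟨K, hK, htK, hKV⟩ := exists_compact_subset hVo htV
    have : CompactSpace K := isCompact_iff_compactSpace.1 hK
    obtain ⟨ψ, hψφ, hψm⟩ := hV.exists_extension_on_compact hYclosed hK hKV hδ
    classical
    refine ⟨K, mem_interior_iff_mem_nhds.1 htK,
      fun t => if h : t ∈ K then (fun x => ψ x ⟨t, h⟩, ‖ψ‖) else 0, ?_, fun t ht => ?_⟩
    · rw [continuousOn_iff_continuous_domRestrict]
      have : K.domRestrict (fun t => if h : t ∈ K then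
          ((fun x => ψ x ⟨t, h⟩, ‖ψ‖) : (E → ℝ) × ℝ) else 0) =
          fun t : K => ((fun x => ψ x t, ‖ψ‖) : (E → ℝ) × ℝ) := by
        ext t <;> simp
      rw [this]
      exact (continuous_pi fun x => (ψ x).continuous).prodMk continuous_const
    · simp only [ht, dif_pos]
      refine ⟨fun a b => ?_, fun r a => ?_, fun y => hψφ y ⟨t, ht⟩, fun x => hψm x ⟨t, ht⟩,
        fun x => ((ψ x).norm_coe_le_norm ⟨t, ht⟩).trans (ψ.le_opNorm x)⟩
      · simp
      · simp
  obtain ⟨B, hB⟩ := (isCompact_range (continuous_snd.comp g.continuous)).bddAbove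
  replace hB : ∀ t, (g t).2 ≤ B := fun t => hB ⟨t, rfl⟩
  let ψ : E →ₗ[ℝ] C(X, ℝ) :=
    { toFun := fun x => ⟨fun t => (g t).1 x,
        (continuous_apply x).comp (continuous_fst.comp g.continuous)⟩
      map_add' := fun a b => ContinuousMap.ext fun t => (hg t).1 a b
      map_smul' := fun r a => ContinuousMap.ext fun t => (hg t).2.1 r a }
  refine ⟨ψ.mkContinuous (max B 0) fun x => ?_, fun y => ?_, fun x t => (hg t).2.2.2.1 x⟩
  · refine (ContinuousMap.norm_le _ (by positivity)).2 fun t => ?_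
    refine ((hg t).2.2.2.2 x).trans ?_
    gcongr
    exact (hB t).trans (le_max_left _ _)
  · exact ContinuousMap.ext fun t => (hg t).2.2.1 y
end

section
/- Let A be a unital C*-algebra, X a compact Hausdorff space, and φ : A → C(X,ℂ) a self-adjoint absolutely continuous linear map. Suppose ψ₊, ψ₋ and χ₊, χ₋ are two pairs of positive linear maps A → C(X,ℂ) with φ = ψ₊ − ψ₋ = χ₊ − χ₋ and such that for every t ∈ X one has ‖φ_t‖ = ‖(ψ₊)_t‖ + ‖(ψ₋)_t‖ and ‖φ_t‖ = ‖(χ₊)_t‖ + ‖(χ₋)_t‖. Then ψ₊ = χ₊ and ψ₋ = χ₋. -/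
/-- For a bounded linear map `φ : A → C(X, ℂ)` and `t ∈ X`, the functional
`φ_t : A → ℂ`, `a ↦ φ(a)(t)`, obtained by composing with evaluation at `t`. -/
noncomputable def fiberFunctional {A : Type*} [CStarAlgebra A]
    {X : Type*} [TopologicalSpace X] [CompactSpace X]
    (φ : A →L[ℂ] C(X, ℂ)) (t : X) : A →L[ℂ] ℂ :=
  (ContinuousMap.evalCLM ℂ t).comp φ

/-- A linear map `ψ : A → C(X, ℂ)` is positive if `ψ a` is a nonnegative
real-valued function whenever `0 ≤ a` in `A`. -/
def IsPosMap {A : Type*} [CStarAlgebra A] [PartialOrder A] [StarOrderedRing A]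
    {X : Type*} [TopologicalSpace X] [CompactSpace X]
    (ψ : A →L[ℂ] C(X, ℂ)) : Prop :=
  ∀ a : A, 0 ≤ a → ∀ t : X, (ψ a t).im = 0 ∧ 0 ≤ (ψ a t).re

section JordanUniqueness

open scoped ComplexOrder ComplexStarModule

variable {A : Type*} [CStarAlgebra A]

lemma re_apply_one_le_norm (p : A →L[ℂ] ℂ) : (p 1).re ≤ ‖p‖ := by
  have h1 : ‖(1 : A)‖ ≤ 1 := by
    nontriviality A
    exact CStarRing.norm_one.le
  exact (Complex.re_le_norm _).trans (p.unit_le_opNorm 1 h1)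

/-- A self-adjoint functional almost attains its norm on self-adjoint contractions. -/
lemma exists_isSelfAdjoint_lt_re_apply (f : A →L[ℂ] ℂ) (hf : ∀ a, f (star a) = star (f a))
    {r : ℝ} (hr : r < ‖f‖) : ∃ a : A, IsSelfAdjoint a ∧ ‖a‖ ≤ 1 ∧ r < (f a).re := by
  obtain ⟨b, hb1, hb⟩ := f.exists_lt_apply_of_lt_opNorm hr
  obtain ⟨c, hc1, hc⟩ := RCLike.exists_norm_eq_mul_self (f b)
  refine ⟨ℜ (c • b), (ℜ (c • b)).2, (realPart.norm_le (c • b)).trans ?_, ?_⟩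
  · rw [norm_smul, hc1, one_mul]
    exact hb1.le
  · have hre : (f (ℜ (c • b) : A)).re = ‖f b‖ := by
      have hcb : f (c • b) = (‖f b‖ : ℂ) := by rw [map_smul, smul_eq_mul, ← hc]; rfl
      rw [realPart_apply_coe, ← Complex.coe_smul, map_smul, map_add, hf, hcb]
      simp
      ring
    rwa [hre]

variable [PartialOrder A] [StarOrderedRing A]

/-- The Cauchy–Schwarz inequality for a positive functional, with a positive contraction as one
of the factors. -/
lemma norm_apply_mul_le_sqrt_mul_sqrt (g : A →ₚ[ℂ] ℂ) {k : A} (hk0 : 0 ≤ k) (hk1 : k ≤ 1)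
    (x : A) : ‖g (k * x)‖ ≤ √(g k).re * √(g (star x * x)).re := by
  have hcs := norm_inner_le_norm (𝕜 := ℂ) (g.toPreGNS k) (g.toPreGNS x)
  simp only [g.preGNS_inner_def, g.preGNS_norm_def, g.ofPreGNS_toPreGNS,
    (IsSelfAdjoint.of_nonneg hk0).star_eq] at hcs
  refine hcs.trans (mul_le_mul_of_nonneg_right (Real.sqrt_le_sqrt ?_) (Real.sqrt_nonneg _))
  have hsq : k * k ≤ k := by
    simpa [pow_two] using CStarAlgebra.pow_antitone hk0 hk1 one_le_two
  exact (Complex.le_def.mp (OrderHomClass.mono g hsq)).1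

/-- If `f = p - m` with `p`, `m` positive and `h` is a positive contraction on which `m` and
`p (1 - ·)` are both small, then `p` is close to `f (h * ·)`. -/
lemma norm_sub_apply_mul_le (f : A → ℂ) (p m : A →ₚ[ℂ] ℂ) (hpm : ∀ x, f x = p x - m x)
    {h : A} (h0 : 0 ≤ h) (h1 : h ≤ 1) {δ : ℝ} (hδ : 0 ≤ δ)
    (hsmall : (p (1 - h)).re + (m h).re ≤ δ ^ 2) (x : A) :
    ‖p x - f (h * x)‖ ≤ δ * (√(p (star x * x)).re + √(m (star x * x)).re) := by
  have h0' : 0 ≤ 1 - h := sub_nonneg.mpr h1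
  have hp0 : 0 ≤ (p (1 - h)).re := (Complex.le_def.mp (p.map_nonneg h0')).1
  have hm0 : 0 ≤ (m h).re := (Complex.le_def.mp (m.map_nonneg h0)).1
  have hp := norm_apply_mul_le_sqrt_mul_sqrt p h0' (sub_le_self 1 h0) x
  have hm := norm_apply_mul_le_sqrt_mul_sqrt m h0 h1 x
  have hps : √(p (1 - h)).re ≤ δ := (Real.sqrt_le_left hδ).mpr (by linarith)
  have hms : √(m h).re ≤ δ := (Real.sqrt_le_left hδ).mpr (by linarith)
  have heq : p x - f (h * x) = p ((1 - h) * x) + m (h * x) := by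
    rw [hpm, sub_mul, one_mul, map_sub]
    ring
  rw [heq, mul_add]
  refine (norm_add_le _ _).trans (add_le_add (hp.trans ?_) (hm.trans ?_)) <;> gcongr

/-- A self-adjoint functional `f` admits positive contractions `h` which almost separate the two
parts of every Jordan decomposition of `f`. -/
lemma exists_contraction_forall_decomposition_le (f : A →L[ℂ] ℂ)
    (hf : ∀ a, f (star a) = star (f a)) {ε : ℝ} (hε : 0 < ε) :
    ∃ h : A, 0 ≤ h ∧ h ≤ 1 ∧ ∀ p m : A →L[ℂ] ℂ, f = p - m → ‖f‖ = ‖p‖ + ‖m‖ →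
      (p (1 - h)).re + (m h).re ≤ ε := by
  obtain ⟨a, ha, ha1, hlt⟩ := exists_isSelfAdjoint_lt_re_apply f hf (sub_lt_self ‖f‖ hε)
  have hle : algebraMap ℝ A ‖a‖ ≤ 1 := by
    simpa using algebraMap_mono A ha1
  have hup : a ≤ 1 := ha.le_algebraMap_norm_self.trans hle
  have hlow : -1 ≤ a := (neg_le_neg hle).trans ha.neg_algebraMap_norm_le_self
  have hsub : 1 - (2⁻¹ : ℝ) • (1 + a) = (2⁻¹ : ℝ) • (1 - a) := by module
  refine ⟨(2⁻¹ : ℝ) • (1 + a), smul_nonneg (by norm_num) (neg_le_iff_add_nonneg'.mp hlow),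
    sub_nonneg.mp (hsub ▸ smul_nonneg (by norm_num) (sub_nonneg.mpr hup)), ?_⟩
  intro p m hpm hnorm
  have hp := re_apply_one_le_norm p
  have hm := re_apply_one_le_norm m
  rw [hnorm, hpm] at hlt
  simp only [_root_.sub_apply, Complex.sub_re] at hlt
  rw [hsub, ← Complex.coe_smul, ← Complex.coe_smul, map_smul, map_smul, map_sub, map_add]
  simp
  linarith

/-- Uniqueness of the Jordan decomposition of a self-adjoint functional. -/
lemma jordan_decomposition_pos_part_unique (f : A →L[ℂ] ℂ)
    (hf : ∀ a, f (star a) = star (f a)) (p m q n : A →L[ℂ] ℂ)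
    (hp : ∀ a, 0 ≤ a → 0 ≤ p a) (hm : ∀ a, 0 ≤ a → 0 ≤ m a)
    (hq : ∀ a, 0 ≤ a → 0 ≤ q a) (hn : ∀ a, 0 ≤ a → 0 ≤ n a)
    (hpm : f = p - m) (hqn : f = q - n)
    (hpm_norm : ‖f‖ = ‖p‖ + ‖m‖) (hqn_norm : ‖f‖ = ‖q‖ + ‖n‖) : p = q := by
  ext x
  let P := PositiveLinearMap.mk₀ (p : A →ₗ[ℂ] ℂ) hp
  let M := PositiveLinearMap.mk₀ (m : A →ₗ[ℂ] ℂ) hm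
  let Q := PositiveLinearMap.mk₀ (q : A →ₗ[ℂ] ℂ) hq
  let N := PositiveLinearMap.mk₀ (n : A →ₗ[ℂ] ℂ) hn
  set K := √(P (star x * x)).re + √(M (star x * x)).re +
    (√(Q (star x * x)).re + √(N (star x * x)).re)
  have hbound : ∀ δ : ℝ, 0 < δ → ‖p x - q x‖ ≤ δ * K := by
    intro δ hδ
    obtain ⟨h, h0, h1, hsmall⟩ :=
      exists_contraction_forall_decomposition_le f hf (pow_pos hδ 2)
    have hP := norm_sub_apply_mul_le f P M (fun y ↦ by rw [hpm]; rfl) h0 h1 hδ.le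
      (hsmall p m hpm hpm_norm) x
    have hQ := norm_sub_apply_mul_le f Q N (fun y ↦ by rw [hqn]; rfl) h0 h1 hδ.le
      (hsmall q n hqn hqn_norm) x
    calc ‖p x - q x‖ = ‖(P x - f (h * x)) - (Q x - f (h * x))‖ := by
          rw [sub_sub_sub_cancel_right]; rfl
      _ ≤ _ := norm_sub_le _ _
      _ ≤ δ * K := by rw [mul_add]; exact add_le_add hP hQ
  have hlim : Filter.Tendsto (fun δ : ℝ ↦ δ * K) (nhdsWithin 0 (Set.Ioi 0)) (nhds 0) := by
    have hcont : Continuous fun δ : ℝ ↦ δ * K := by fun_prop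
    simpa using (hcont.tendsto 0).mono_left nhdsWithin_le_nhds
  have hle : ‖p x - q x‖ ≤ 0 := ge_of_tendsto hlim (by
    filter_upwards [self_mem_nhdsWithin] with δ hδ using hbound δ hδ)
  exact sub_eq_zero.mp (norm_le_zero_iff.mp hle)

lemma IsPosMap.fiberFunctional_nonneg {X : Type*} [TopologicalSpace X] [CompactSpace X]
    {ψ : A →L[ℂ] C(X, ℂ)} (hψ : IsPosMap ψ) (t : X) (a : A) (ha : 0 ≤ a) :
    0 ≤ fiberFunctional ψ t a :=
  Complex.le_def.mpr ⟨(hψ a ha t).2, (hψ a ha t).1.symm⟩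

end JordanUniqueness

/-- Lemma 2, uniqueness of the Jordan decomposition.  Let `φ` be a
self-adjoint absolutely continuous bounded linear map `A → C(X, ℂ)`.  If
`φ = ψ₊ - ψ₋ = χ₊ - χ₋` are two decompositions of `φ` into differences of positive
linear maps whose pointwise fiber norms add up to `‖φ_t‖` at every `t ∈ X`, then
`ψ₊ = χ₊` and `ψ₋ = χ₋`. -/
theorem stmt3
    {A : Type*} [CStarAlgebra A] [PartialOrder A] [StarOrderedRing A]
    {X : Type*} [TopologicalSpace X] [CompactSpace X] [T2Space X]
    (φ : A →L[ℂ] C(X, ℂ))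
    (hsa : ∀ a : A, φ (star a) = star (φ a))
    (hac : Continuous fun t : X => ‖fiberFunctional φ t‖)
    (ψp ψm χp χm : A →L[ℂ] C(X, ℂ))
    (hψp : IsPosMap ψp) (hψm : IsPosMap ψm)
    (hχp : IsPosMap χp) (hχm : IsPosMap χm)
    (hψ : φ = ψp - ψm) (hχ : φ = χp - χm)
    (hψnorm : ∀ t : X, ‖fiberFunctional φ t‖ =
      ‖fiberFunctional ψp t‖ + ‖fiberFunctional ψm t‖)
    (hχnorm : ∀ t : X, ‖fiberFunctional φ t‖ =
      ‖fiberFunctional χp t‖ + ‖fiberFunctional χm t‖) :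
    ψp = χp ∧ ψm = χm := by
  have hp : ψp = χp := by
    ext a t
    refine congrArg (fun g : A →L[ℂ] ℂ ↦ g a) <|
      jordan_decomposition_pos_part_unique (fiberFunctional φ t)
        (fun b ↦ congrArg (fun g : C(X, ℂ) ↦ g t) (hsa b))
        (fiberFunctional ψp t) (fiberFunctional ψm t)
        (fiberFunctional χp t) (fiberFunctional χm t)
        (hψp.fiberFunctional_nonneg t) (hψm.fiberFunctional_nonneg t)
        (hχp.fiberFunctional_nonneg t) (hχm.fiberFunctional_nonneg t)
        ?_ ?_ (hψnorm t) (hχnorm t)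
    · rw [hψ]; rfl
    · rw [hχ]; rfl
  refine ⟨hp, ?_⟩
  rw [hψ, hp] at hχ
  exact sub_right_injective hχ
end

section
/- Let X be a compact Hausdorff space and let A be a unital C*-algebra containing C(X,ℂ) as a unital C*-subalgebra of its center, via a unital isometric *-embedding ι : C(X,ℂ) → A. Let φ : A → C(X,ℂ) be a self-adjoint absolutely continuous linear map which is C(X)-linear, i.e. φ(ι(b)·a) = b·φ(a) for all b ∈ C(X,ℂ) and a ∈ A. Then there exist positive C(X)-linear maps φ₊, φ₋ : A → C(X,ℂ) such that φ = φ₊ − φ₋ and, for every t ∈ X, ‖φ_t‖ = ‖(φ₊)_t‖ + ‖(φ₋)_t‖. -/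
open scoped ComplexOrder Topology

namespace PositiveLinearMap

variable {A : Type*} [CStarAlgebra A] [PartialOrder A]

lemma re_apply_nonneg (f : A →ₚ[ℂ] ℂ) {a : A} (ha : 0 ≤ a) : 0 ≤ (f a).re :=
  (Complex.nonneg_iff.mp (f.map_nonneg ha)).1

lemma re_apply_mono (f : A →ₚ[ℂ] ℂ) {a b : A} (hab : a ≤ b) : (f a).re ≤ (f b).re :=
  (Complex.le_def.mp (OrderHomClass.mono f hab)).1

variable [StarOrderedRing A]

/-- The Cauchy-Schwarz inequality for a positive functional on a C*-algebra. -/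
lemma norm_apply_mul_sq_le (f : A →ₚ[ℂ] ℂ) (c x : A) :
    ‖f (c * x)‖ ^ 2 ≤ (f (c * star c)).re * (f (star x * x)).re := by
  have h := inner_mul_inner_self_le (𝕜 := ℂ) (f.toPreGNS (star c)) (f.toPreGNS x)
  rw [norm_inner_symm (f.toPreGNS x)] at h
  simpa only [preGNS_inner_def, sq, ofPreGNS_toPreGNS, star_star,
    RCLike.re_eq_complex_re] using h

lemma re_apply_star_mul_self_le (f : A →ₚ[ℂ] ℂ) (x : A) :
    (f (star x * x)).re ≤ (f 1).re * ‖x‖ ^ 2 := by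
  have h := f.re_apply_mono (CStarAlgebra.star_mul_le_algebraMap_norm_sq (a := x))
  rw [Algebra.algebraMap_eq_smul_one, ← Complex.coe_smul, map_smul, smul_eq_mul,
    Complex.re_ofReal_mul] at h
  linarith

lemma norm_apply_mul_le (f : A →ₚ[ℂ] ℂ) {c : A} (hc : 0 ≤ c) (hc1 : c ≤ 1) (x : A) :
    ‖f (c * x)‖ ≤ √((f c).re * (f 1).re) * ‖x‖ := by
  have hcc : c * star c ≤ c := by
    rw [(IsSelfAdjoint.of_nonneg hc).star_eq]
    simpa [sq] using CStarAlgebra.pow_antitone hc hc1 (show 1 ≤ 2 by norm_num)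
  have h1 := f.re_apply_nonneg hc
  have h2 := f.re_apply_nonneg (zero_le_one (α := A))
  rw [← sq_le_sq₀ (norm_nonneg _) (by positivity), mul_pow, Real.sq_sqrt (by positivity), mul_assoc]
  exact (f.norm_apply_mul_sq_le c x).trans <| mul_le_mul (f.re_apply_mono hcc)
    (f.re_apply_star_mul_self_le x) (f.re_apply_nonneg (star_mul_self_nonneg x)) h1

lemma norm_apply_le (f : A →ₚ[ℂ] ℂ) (x : A) : ‖f x‖ ≤ (f 1).re * ‖x‖ := by
  have h2 := f.re_apply_nonneg (zero_le_one (α := A))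
  simpa [Real.sqrt_mul_self h2] using f.norm_apply_mul_le zero_le_one le_rfl x

/-- A positive real functional on the self-adjoint part extends to a positive functional. -/
lemma exists_extend_selfAdjoint (h : selfAdjoint A →ₗ[ℝ] ℝ)
    (hh : ∀ a : selfAdjoint A, 0 ≤ (a : A) → 0 ≤ h a) :
    ∃ f : A →ₚ[ℂ] ℂ, ∀ a : selfAdjoint A, f a = h a := by
  let F : A →ₗ[ℂ] ℂ := Module.Dual.extendRCLike (𝕜 := ℂ) (h ∘ₗ realPart)
  have hF (a : selfAdjoint A) : F a = h a := by
    simp [F, Module.Dual.extendRCLike_apply, realPart_I_smul, selfAdjoint.imaginaryPart_coe]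
  refine ⟨PositiveLinearMap.mk₀ F fun a ha ↦ ?_, hF⟩
  have := hF ⟨a, IsSelfAdjoint.of_nonneg ha⟩
  simp only at this
  rw [this]
  exact_mod_cast hh _ ha

/-- Near-attainment of the norm of `ψ = f - g` on a positive contraction `e` makes `f` close to
`ψ (e * ·)`. -/
lemma norm_sub_apply_mul_le {ψ : A →L[ℂ] ℂ} {f g : A →ₚ[ℂ] ℂ} (hψ : ∀ a, ψ a = f a - g a)
    (hn : (f 1).re + (g 1).re = ‖ψ‖) {e : A} (he : 0 ≤ e) (he1 : e ≤ 1) (x : A) :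
    ‖f x - ψ (e * x)‖ ≤ 2 * √(((‖ψ‖ + (ψ 1).re) / 2 - (ψ e).re) * ‖ψ‖) * ‖x‖ := by
  set δ := (‖ψ‖ + (ψ 1).re) / 2 - (ψ e).re with hδ
  have hf1 := f.re_apply_nonneg (zero_le_one (α := A))
  have hg1 := g.re_apply_nonneg (zero_le_one (α := A))
  have hfe := f.re_apply_nonneg (sub_nonneg.2 he1)
  have hge := g.re_apply_nonneg he
  have hsum : (f (1 - e)).re + (g e).re = δ := by
    rw [hδ, ← hn, hψ, hψ, map_sub]
    simp only [Complex.sub_re]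
    ring
  have hx : f x - ψ (e * x) = f ((1 - e) * x) + g (e * x) := by
    rw [hψ, sub_mul, one_mul, map_sub]
    ring
  have b1 : ‖f ((1 - e) * x)‖ ≤ √(δ * ‖ψ‖) * ‖x‖ :=
    (f.norm_apply_mul_le (sub_nonneg.2 he1) (by simpa using he) x).trans <| by
      gcongr <;> linarith
  have b2 : ‖g (e * x)‖ ≤ √(δ * ‖ψ‖) * ‖x‖ :=
    (g.norm_apply_mul_le he he1 x).trans <| by
      gcongr <;> linarith
  rw [hx]
  linarith [norm_add_le (f ((1 - e) * x)) (g (e * x))]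

end PositiveLinearMap

section Hermitian

variable {A : Type*} [CStarAlgebra A]

lemma coe_re_apply_of_isSelfAdjoint {ψ : A →L[ℂ] ℂ} (hψ : ∀ a, ψ (star a) = star (ψ a))
    (a : selfAdjoint A) : ((ψ a).re : ℂ) = ψ a := by
  rw [← Complex.conj_eq_iff_re, ← Complex.star_def, ← hψ, a.2.star_eq]

variable [PartialOrder A] [StarOrderedRing A]

/-- The cone used to extract the positive and negative parts of a hermitian functional. -/
def upperBoundCone (A : Type*) [CStarAlgebra A] [PartialOrder A] [StarOrderedRing A] :
    PointedCone ℝ (selfAdjoint A × selfAdjoint A × ℝ) where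
  carrier := {p | 0 ≤ p.2.2 ∧ 0 ≤ (p.1 : A) + algebraMap ℝ A p.2.2 ∧
    0 ≤ (p.2.1 : A) + algebraMap ℝ A p.2.2}
  zero_mem' := by simp
  add_mem' := by
    rintro ⟨a, b, s⟩ ⟨a', b', s'⟩ ⟨h1, h2, h3⟩ ⟨h1', h2', h3'⟩
    refine ⟨add_nonneg h1 h1', ?_, ?_⟩
    · simpa [add_add_add_comm] using add_nonneg h2 h2'
    · simpa [add_add_add_comm] using add_nonneg h3 h3'
  smul_mem' := by
    rintro ⟨c, hc⟩ ⟨a, b, s⟩ ⟨h1, h2, h3⟩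
    refine ⟨mul_nonneg hc h1, ?_, ?_⟩
    · simpa [Algebra.algebraMap_eq_smul_one, mul_smul] using smul_nonneg hc h2
    · simpa [Algebra.algebraMap_eq_smul_one, mul_smul] using smul_nonneg hc h3

/-- The domain `{(a, -a, s)}` of the functional to be extended. -/
def antidiagonal (A : Type*) [CStarAlgebra A] :
    Submodule ℝ (selfAdjoint A × selfAdjoint A × ℝ) where
  carrier := {p | p.1 + p.2.1 = 0}
  zero_mem' := by simp
  add_mem' := by
    rintro ⟨a, b, s⟩ ⟨a', b', s'⟩ h h'
    simp only [Set.mem_ofPred_eq, Prod.mk_add_mk] at *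
    rw [add_add_add_comm, h, h', add_zero]
  smul_mem' := by
    rintro c ⟨a, b, s⟩ h
    simp only [Set.mem_ofPred_eq, Prod.smul_mk] at *
    rw [← smul_add, h, smul_zero]

lemma norm_le_of_add_algebraMap_nonneg {a : selfAdjoint A} {s : ℝ} (hs : 0 ≤ s)
    (h1 : 0 ≤ (a : A) + algebraMap ℝ A s) (h2 : 0 ≤ -(a : A) + algebraMap ℝ A s) :
    ‖(a : A)‖ ≤ s := by
  rcases subsingleton_or_nontrivial A with _ | _
  · simpa [Subsingleton.elim (a : A) 0] using hs
  have h2' : (a : A) ≤ algebraMap ℝ A s := by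
    rwa [neg_add_eq_sub, sub_nonneg] at h2
  have h1' : algebraMap ℝ A (-s) ≤ (a : A) := by
    rw [map_neg]
    exact neg_le_iff_add_nonneg.2 h1
  have hm := (le_algebraMap_iff_spectrum_le a.2).1 h2'
  have hm' := (algebraMap_le_iff_le_spectrum a.2).1 h1'
  rcases CStarAlgebra.norm_or_neg_norm_mem_spectrum a.2 with h | h
  · exact hm _ h
  · linarith [hm' _ h]

/-- Jordan decomposition of a hermitian functional on a C*-algebra. -/
theorem exists_jordan_decomposition {ψ : A →L[ℂ] ℂ} (hψ : ∀ a, ψ (star a) = star (ψ a)) :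
    ∃ f g : A →ₚ[ℂ] ℂ, (∀ a, ψ a = f a - g a) ∧ (f 1).re + (g 1).re = ‖ψ‖ := by
  let r : selfAdjoint A →ₗ[ℝ] ℝ :=
    Complex.reLm ∘ₗ (ψ : A →ₗ[ℂ] ℂ).restrictScalars ℝ ∘ₗ (selfAdjoint.submodule ℝ A).subtype
  have hr (a : selfAdjoint A) : r a = (ψ a).re := rfl
  let L : selfAdjoint A × selfAdjoint A × ℝ →ₗ[ℝ] ℝ :=
    r.coprod ((0 : selfAdjoint A →ₗ[ℝ] ℝ).coprod (LinearMap.lsmul ℝ ℝ ‖ψ‖))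
  have hL (a b : selfAdjoint A) (s : ℝ) : L (a, b, s) = (ψ a).re + ‖ψ‖ * s := by simp [L, hr]
  obtain ⟨F, hF, hF0⟩ := riesz_extension (upperBoundCone A)
    ⟨antidiagonal A, L ∘ₗ (antidiagonal A).subtype⟩
    (by
      rintro ⟨⟨a, b, s⟩, hab⟩ ⟨hs, h1, h2⟩
      obtain rfl : b = -a := (neg_eq_of_add_eq_zero_right hab).symm
      have hn := norm_le_of_add_algebraMap_nonneg hs h1 h2
      change 0 ≤ L (a, -a, s)
      rw [hL]
      have h3 := (abs_le.1 ((Complex.abs_re_le_norm _).trans (ψ.le_opNorm a))).1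
      nlinarith [mul_le_mul_of_nonneg_left hn (norm_nonneg ψ)])
    (by
      rintro ⟨a, b, s⟩
      refine ⟨⟨(0, 0, ‖a‖ + ‖b‖ + |s|), by simp [antidiagonal]⟩, ?_⟩
      have hm (c : selfAdjoint A) (t : ℝ) (h : ‖c‖ ≤ t) : 0 ≤ (c : A) + algebraMap ℝ A t := by
        rw [← neg_le_iff_add_nonneg']
        have := IsSelfAdjoint.le_algebraMap_norm_self (a := -(c : A)) c.2.neg
        rw [norm_neg] at this
        exact this.trans (algebraMap_mono A h)
      have hs := neg_abs_le s
      refine ⟨?_, ?_, ?_⟩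
      · simp only [Prod.mk_add_mk]
        linarith [norm_nonneg a, norm_nonneg b]
      · simp only [Prod.mk_add_mk, zero_add]
        exact hm a _ (by linarith [norm_nonneg b])
      · simp only [Prod.mk_add_mk, zero_add]
        exact hm b _ (by linarith [norm_nonneg a]))
  have hF' (a : selfAdjoint A) (s : ℝ) : F (a, -a, s) = (ψ a).re + ‖ψ‖ * s := by
    rw [← hL a (-a) s]
    exact hF ⟨(a, -a, s), by simp [antidiagonal]⟩
  obtain ⟨f, hf⟩ := PositiveLinearMap.exists_extend_selfAdjoint
    (F ∘ₗ LinearMap.inl ℝ (selfAdjoint A) (selfAdjoint A × ℝ))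
    (fun a ha ↦ hF0 _ ⟨le_rfl, by simpa using ha, by simp⟩)
  obtain ⟨g, hg⟩ := PositiveLinearMap.exists_extend_selfAdjoint
    (F ∘ₗ LinearMap.inr ℝ (selfAdjoint A) (selfAdjoint A × ℝ) ∘ₗ
      LinearMap.inl ℝ (selfAdjoint A) ℝ)
    (fun a ha ↦ hF0 _ ⟨le_rfl, by simp, by simpa using ha⟩)
  have hsa (a : selfAdjoint A) : ψ a = f a - g a := by
    rw [hf, hg, ← coe_re_apply_of_isSelfAdjoint hψ, ← Complex.ofReal_sub]
    have h0 := hF' a 0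
    simp only [mul_zero, add_zero] at h0
    simp [← h0, ← map_sub]
  have hfg (a : A) : ψ a = f a - g a := by
    rw [← realPart_add_I_smul_imaginaryPart a]
    simp only [map_add, map_smul, hsa]
    simp only [smul_eq_mul]
    ring
  have hf1 := f.re_apply_nonneg (zero_le_one (α := A))
  have hg1 := g.re_apply_nonneg (zero_le_one (α := A))
  refine ⟨f, g, hfg, le_antisymm ?_ ?_⟩
  · have h1 := hF0 (-1, -1, 1) ⟨zero_le_one, by simp, by simp⟩
    have h2 := hF' 0 1
    have e1 := congrArg Complex.re (hf 1)
    have e2 := congrArg Complex.re (hg 1)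
    have h3 : F (-1, -1, 1) = F (0, -0, 1) - F (1, 0, 0) - F (0, 1, 0) := by
      simp [← map_sub]
    change (f 1).re = F (1, 0, 0) at e1
    change (g 1).re = F (0, 1, 0) at e2
    simp only [ZeroMemClass.coe_zero, map_zero, Complex.zero_re, mul_one, zero_add] at h2
    linarith
  · refine ψ.opNorm_le_bound (by positivity) fun x ↦ ?_
    rw [hfg, add_mul]
    exact (norm_sub_le _ _).trans (add_le_add (f.norm_apply_le x) (g.norm_apply_le x))

/-- A hermitian functional nearly attains its norm on `2 e - 1` for a positive contraction `e`. -/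
lemma exists_nearly_norming {ψ : A →L[ℂ] ℂ} (hψ : ∀ a, ψ (star a) = star (ψ a))
    {ε : ℝ} (hε : 0 < ε) :
    ∃ e : A, 0 ≤ e ∧ e ≤ 1 ∧ (‖ψ‖ + (ψ 1).re) / 2 - (ψ e).re < ε := by
  obtain ⟨x, hx, hxψ⟩ := ψ.exists_lt_apply_of_lt_opNorm (sub_lt_self ‖ψ‖ hε)
  obtain ⟨u, hu, hux⟩ := Complex.exists_norm_eq_mul_self (ψ x)
  have hux' : ψ (u • x) = ‖ψ x‖ := by rw [map_smul, smul_eq_mul, hux]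
  let a : selfAdjoint A := realPart (u • x)
  have ha : ‖(a : A)‖ ≤ 1 := by
    refine (realPart.norm_le (u • x)).trans ?_
    simpa [norm_smul, hu] using hx.le
  have hψa : (ψ a).re = ‖ψ x‖ := by
    rw [realPart_apply_coe, ← Complex.coe_smul, map_smul, map_add, hψ, hux']
    simp
    ring
  have ha1 : (a : A) ≤ 1 := (IsSelfAdjoint.le_algebraMap_norm_self a.2).trans <| by
    simpa using algebraMap_mono A ha
  have ha2 : -1 ≤ (a : A) := by
    refine le_trans ?_ (IsSelfAdjoint.neg_algebraMap_norm_le_self a.2)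
    simpa using algebraMap_mono A ha
  refine ⟨(2⁻¹ : ℝ) • (1 + (a : A)), smul_nonneg (by norm_num) (neg_le_iff_add_nonneg'.1 ha2),
    ?_, ?_⟩
  · calc (2⁻¹ : ℝ) • (1 + (a : A)) ≤ (2⁻¹ : ℝ) • (1 + 1) := by gcongr
      _ = 1 := by rw [← two_smul ℝ (1 : A), smul_smul]; norm_num
  · rw [← Complex.coe_smul, map_smul, map_add, smul_eq_mul, Complex.re_ofReal_mul, Complex.add_re,
      hψa]
    linarith

end Hermitian

/-- Remark (i).  Let `X` be a compact Hausdorff space and `A` a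
unital C*-algebra containing `C(X, ℂ)` as a unital C*-subalgebra of its center, via a
unital isometric *-embedding `ι`.  If `φ : A → C(X, ℂ)` is a self-adjoint absolutely
continuous linear map which is moreover `C(X)`-linear, then the positive parts of its
Jordan decomposition can be chosen `C(X)`-linear as well: there are positive
`C(X)`-linear maps `φ₊, φ₋` with `φ = φ₊ - φ₋` and
`‖φ_t‖ = ‖(φ₊)_t‖ + ‖(φ₋)_t‖` for every `t`. -/
theorem stmt8
    {A : Type*} [CStarAlgebra A] [PartialOrder A] [StarOrderedRing A]
    {X : Type*} [TopologicalSpace X] [CompactSpace X] [T2Space X]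
    (ι : C(X, ℂ) →⋆ₐ[ℂ] A)
    (hι_isom : Isometry ι)
    (hι_central : ∀ b : C(X, ℂ), ι b ∈ Set.center A)
    (φ : A →L[ℂ] C(X, ℂ))
    (hsa : ∀ a : A, φ (star a) = star (φ a))
    (hac : Continuous fun t : X => ‖fiberFunctional φ t‖)
    (hmod : ∀ (b : C(X, ℂ)) (a : A), φ (ι b * a) = b * φ a) :
    ∃ φp φm : A →L[ℂ] C(X, ℂ), IsPosMap φp ∧ IsPosMap φm ∧
      (∀ (b : C(X, ℂ)) (a : A), φp (ι b * a) = b * φp a) ∧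
      (∀ (b : C(X, ℂ)) (a : A), φm (ι b * a) = b * φm a) ∧
      φ = φp - φm ∧
      ∀ t : X, ‖fiberFunctional φ t‖ =
        ‖fiberFunctional φp t‖ + ‖fiberFunctional φm t‖ := by
  have hsa' (t : X) (a : A) : fiberFunctional φ t (star a) = star (fiberFunctional φ t a) := by
    simp [fiberFunctional, hsa]
  choose f g hfg hn using fun t ↦ exists_jordan_decomposition (hsa' t)
  have happ (t : X) (a : A) : fiberFunctional φ t a = φ a t := rfl
  set ψ := fiberFunctional φ
  have happrox (t₀ : X) (C ε : ℝ) (hC : 0 ≤ C) (hε : 0 < ε) : ∃ e : A,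
      ∀ᶠ t in 𝓝 t₀, ∀ x, ‖x‖ ≤ C → ‖f t x - ψ t (e * x)‖ < ε := by
    let M := 2 * C * √(‖ψ t₀‖ + 1) + 1
    have hM : 0 < M := by positivity
    obtain ⟨e, he, he1, hlt⟩ := exists_nearly_norming (hsa' t₀) (ε := (ε / M) ^ 2) (by positivity)
    refine ⟨e, ?_⟩
    have hcont (a : A) : Continuous fun t ↦ (ψ t a).re :=
      Complex.continuous_re.comp (φ a).continuous
    have h1 : ∀ᶠ t in 𝓝 t₀, (‖ψ t‖ + (ψ t 1).re) / 2 - (ψ t e).re < (ε / M) ^ 2 :=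
      (((hac.add (hcont 1)).div_const 2).sub (hcont e)).continuousAt.eventually_lt_const hlt
    have h2 : ∀ᶠ t in 𝓝 t₀, ‖ψ t‖ < ‖ψ t₀‖ + 1 :=
      hac.continuousAt.eventually_lt_const (lt_add_one _)
    filter_upwards [h1, h2] with t ht1 ht2 x hx
    calc ‖f t x - ψ t (e * x)‖
        ≤ 2 * √(((‖ψ t‖ + (ψ t 1).re) / 2 - (ψ t e).re) * ‖ψ t‖) * ‖x‖ :=
          PositiveLinearMap.norm_sub_apply_mul_le (hfg t) (hn t) he he1 x
      _ ≤ 2 * √((ε / M) ^ 2 * (‖ψ t₀‖ + 1)) * C := by gcongr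
      _ = ε * ((2 * C * √(‖ψ t₀‖ + 1)) / M) := by
          rw [Real.sqrt_mul (by positivity), Real.sqrt_sq (by positivity)]
          ring
      _ < ε := mul_lt_of_lt_one_right hε ((div_lt_one hM).2 (lt_add_one _))
  have hcont (x : A) : Continuous fun t ↦ f t x := by
    refine continuous_iff_continuousAt.2 fun t₀ ↦ Metric.continuousAt_iff'.2 fun ε hε ↦ ?_
    obtain ⟨e, he⟩ := happrox t₀ ‖x‖ (ε / 3) (norm_nonneg x) (by positivity)
    have h0 := he.self_of_nhds x le_rfl
    have h1 := Metric.continuousAt_iff'.1 ((φ (e * x)).continuous.continuousAt (x := t₀))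
      (ε / 3) (by positivity)
    filter_upwards [he, h1] with t ht ht1
    have ht := ht x le_rfl
    rw [happ, ← dist_eq_norm] at ht h0
    have := dist_triangle4_right (f t x) (f t₀ x) (φ (e * x) t) (φ (e * x) t₀)
    linarith
  have hbound (t : X) (x : A) : ‖f t x‖ ≤ ‖φ‖ * ‖x‖ := by
    have h1 : ‖ψ t‖ ≤ ‖φ‖ := (ψ t).opNorm_le_bound (norm_nonneg _) fun a ↦
      ((φ a).norm_coe_le_norm t).trans (φ.le_opNorm a)
    refine ((f t).norm_apply_le x).trans ?_
    gcongr
    linarith [hn t, (g t).re_apply_nonneg (zero_le_one (α := A))]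
  have hlin (t : X) (b : C(X, ℂ)) (x : A) : f t (ι b * x) = b t * f t x := by
    refine eq_of_forall_dist_le fun ε hε ↦ ?_
    obtain ⟨e, he⟩ := happrox t (‖ι b * x‖ + ‖x‖) (ε / (1 + ‖b t‖)) (by positivity) (by positivity)
    have he := he.self_of_nhds
    have h1 := he (ι b * x) (by simp)
    have h2 := he x (by simp)
    have h3 : ψ t (e * (ι b * x)) = b t * ψ t (e * x) := by
      rw [← mul_assoc, ← ((hι_central b).comm e).eq, mul_assoc, happ, hmod]
      rfl
    rw [dist_eq_norm]
    calc ‖f t (ι b * x) - b t * f t x‖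
        = ‖(f t (ι b * x) - ψ t (e * (ι b * x))) - b t * (f t x - ψ t (e * x))‖ := by
          rw [h3]; ring_nf
      _ ≤ ε / (1 + ‖b t‖) + ‖b t‖ * (ε / (1 + ‖b t‖)) := by
          refine (norm_sub_le _ _).trans (add_le_add h1.le ?_)
          rw [norm_mul]
          gcongr
      _ = ε := by field_simp
  let φp : A →L[ℂ] C(X, ℂ) := LinearMap.mkContinuous
    { toFun x := ⟨fun t ↦ f t x, hcont x⟩
      map_add' x y := by ext t; simp
      map_smul' c x := by ext t; simp } ‖φ‖
    fun x ↦ (ContinuousMap.norm_le _ (by positivity)).2 fun t ↦ hbound t x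
  have hp (x : A) (t : X) : φp x t = f t x := rfl
  have hm (x : A) (t : X) : (φp - φ) x t = g t x := by
    change φp x t - φ x t = _
    rw [hp, ← happ, hfg]
    ring
  have hpos (h : A →ₚ[ℂ] ℂ) (a : A) (ha : 0 ≤ a) : (h a).im = 0 ∧ 0 ≤ (h a).re :=
    ⟨(Complex.nonneg_iff.1 (h.map_nonneg ha)).2.symm, h.re_apply_nonneg ha⟩
  have hpmod (b : C(X, ℂ)) (a : A) : φp (ι b * a) = b * φp a := by
    ext t
    exact hlin t b a
  refine ⟨φp, φp - φ, fun a ha t ↦ hp a t ▸ hpos _ a ha, fun a ha t ↦ hm a t ▸ hpos _ a ha, hpmod,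
    fun b a ↦ ?_, by simp, fun t ↦ le_antisymm ?_ ?_⟩
  · simp only [sub_apply, hpmod, hmod, mul_sub]
  · have : ψ t = fiberFunctional φp t - fiberFunctional (φp - φ) t := by
      ext a
      exact hfg t a |>.trans (by rw [← hp, ← hm]; rfl)
    rw [this]
    exact norm_sub_le _ _
  · rw [← hn t]
    refine add_le_add (ContinuousLinearMap.opNorm_le_bound _ ((f t).re_apply_nonneg zero_le_one)
      (f t).norm_apply_le) (ContinuousLinearMap.opNorm_le_bound _ ((g t).re_apply_nonneg zero_le_one)
      fun x ↦ ?_)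
    exact (hm x t).symm ▸ (g t).norm_apply_le x
end
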